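/- arXiv:1309.2071 — 4 statements merged into one kernel-verified Lean document; each statement's English description precedes it below -/
import Mathlib

section
/- Let a : ℝ → ℝ be infinitely differentiable with all derivatives of polynomial growth. Then for every fixed t ∈ [0,1], the random variable C_t^n := 4 Δ_n^{−1} ∫_0^t a²(W_{Δ_n⌊s/Δ_n⌋}) (W_s − W_{Δ_n⌊s/Δ_n⌋})² ds converges in probability, as n → ∞, to C_t := 2 ∫_0^t a²(W_s) ds. -/
open MeasureTheory ProbabilityTheory Filter

theorem tendstoInMeasure_integral_of_asymptotically_orthogonal
    {Ω S : Type*} {mΩ : MeasurableSpace Ω} {mS : MeasurableSpace S}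
    {μ : Measure Ω} [IsFiniteMeasure μ] {ν : Measure S} [IsFiniteMeasure ν]
    {Z : ℕ → Ω → S → ℝ} {C : ℝ}
    (hZ : ∀ n, Measurable (Function.uncurry (Z n)))
    (hint : ∀ n, ∀ᵐ s ∂ν, Integrable (fun ω => Z n ω s ^ 2) μ)
    (hC : ∀ n, ∀ᵐ s ∂ν, ∫ ω, Z n ω s ^ 2 ∂μ ≤ C)
    (horth : ∀ᵐ p ∂ν.prod ν, ∀ᶠ n in atTop, ∫ ω, Z n ω p.1 * Z n ω p.2 ∂μ = 0) :
    TendstoInMeasure μ (fun n ω => ∫ s, Z n ω s ∂ν) atTop 0 := by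
  set F : ℕ → Ω → S × S → ℝ := fun n ω p => Z n ω p.1 * Z n ω p.2 with hF
  have hFm (n : ℕ) : Measurable (Function.uncurry (F n)) :=
    ((hZ n).comp (measurable_fst.prodMk (measurable_fst.comp measurable_snd))).mul
      ((hZ n).comp (measurable_fst.prodMk (measurable_snd.comp measurable_snd)))
  have hFsec (n : ℕ) (p : S × S) : Measurable fun ω => F n ω p :=
    (hFm n).comp (measurable_id.prodMk measurable_const)
  have hpt (n : ℕ) (ω : Ω) (p : S × S) :
      ‖F n ω p‖ ≤ 2⁻¹ * (Z n ω p.1 ^ 2 + Z n ω p.2 ^ 2) := by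
    rw [Real.norm_eq_abs, hF, abs_mul, ← sq_abs (Z n ω p.1), ← sq_abs (Z n ω p.2)]
    nlinarith [sq_nonneg (|Z n ω p.1| - |Z n ω p.2|)]
  have hbound (n : ℕ) : ∀ᵐ p ∂ν.prod ν,
      Integrable (fun ω => F n ω p) μ ∧ ∫ ω, ‖F n ω p‖ ∂μ ≤ C := by
    filter_upwards [Measure.quasiMeasurePreserving_fst.ae (hint n),
      Measure.quasiMeasurePreserving_snd.ae (hint n),
      Measure.quasiMeasurePreserving_fst.ae (hC n),
      Measure.quasiMeasurePreserving_snd.ae (hC n)] with p h1 h2 h3 h4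
    have hsum := (h1.add h2).const_mul 2⁻¹
    have hI : Integrable (fun ω => F n ω p) μ :=
      hsum.mono' (hFsec n p).aestronglyMeasurable (ae_of_all _ fun ω => hpt n ω p)
    refine ⟨hI, (integral_mono hI.norm hsum fun ω => hpt n ω p).trans ?_⟩
    simp only [Pi.add_apply]
    rw [integral_const_mul, integral_add h1 h2]
    linarith
  have hFint (n : ℕ) : Integrable (Function.uncurry (F n)) (μ.prod (ν.prod ν)) := by
    rw [integrable_prod_iff' (hFm n).aestronglyMeasurable]
    refine ⟨(hbound n).mono fun p h => h.1, Integrable.of_bound (C := C) ?_ ?_⟩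
    · exact (hFm n).norm.stronglyMeasurable.integral_prod_left'.aestronglyMeasurable
    · filter_upwards [hbound n] with p h
      rw [Real.norm_of_nonneg (integral_nonneg fun ω => norm_nonneg _)]
      exact h.2
  have hsq (n : ℕ) (ω : Ω) : (∫ s, Z n ω s ∂ν) ^ 2 = ∫ p, F n ω p ∂ν.prod ν := by
    rw [sq, ← integral_prod_mul]
  have hsqint (n : ℕ) : Integrable (fun ω => (∫ s, Z n ω s ∂ν) ^ 2) μ := by
    simp_rw [hsq]
    exact (hFint n).integral_prod_left
  have hlim : Tendsto (fun n => ∫ ω, (∫ s, Z n ω s ∂ν) ^ 2 ∂μ) atTop (nhds 0) := by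
    simp_rw [hsq]
    have heq (n : ℕ) : ∫ ω, ∫ p, F n ω p ∂ν.prod ν ∂μ = ∫ p, ∫ ω, F n ω p ∂μ ∂ν.prod ν :=
      integral_integral_swap (hFint n)
    simp_rw [heq]
    rw [← integral_zero (S × S) ℝ (μ := ν.prod ν)]
    refine tendsto_integral_of_dominated_convergence (fun _ => C) (fun n => ?_)
      (integrable_const _) (fun n => ?_) ?_
    · exact (hFm n).stronglyMeasurable.integral_prod_left'.aestronglyMeasurable
    · filter_upwards [hbound n] with p h
      exact (norm_integral_le_integral_norm _).trans h.2
    · filter_upwards [horth] with p h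
      exact tendsto_const_nhds.congr' (h.mono fun n hn => hn.symm)
  rw [tendstoInMeasure_iff_measureReal_norm]
  intro ε hε
  have hlim' := hlim.const_mul (ε ^ 2)⁻¹
  rw [mul_zero] at hlim'
  refine squeeze_zero (fun n => measureReal_nonneg) (fun n => ?_) hlim'
  have := mul_meas_ge_le_integral_of_nonneg (ae_of_all μ fun ω => sq_nonneg (∫ s, Z n ω s ∂ν))
    (hsqint n) (ε ^ 2)
  rw [inv_mul_eq_div, le_div_iff₀ (by positivity), mul_comm]
  refine le_trans (le_of_eq ?_) this
  congr 3
  ext ω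
  simp [sq_le_sq, abs_of_pos hε]

/-- The largest multiple of the mesh size `d` that is at most `s` (for `d > 0`). -/
noncomputable def gridFloor (d s : ℝ) : ℝ := d * ↑⌊s / d⌋

theorem measurable_gridFloor (d : ℝ) : Measurable (gridFloor d) := by
  unfold gridFloor
  exact measurable_const.mul
    (measurable_from_top.comp (Int.measurable_floor.comp (measurable_id.div_const d)))

theorem gridFloor_le {d : ℝ} (hd : 0 < d) (s : ℝ) : gridFloor d s ≤ s := by
  have := Int.floor_le (s / d)
  rw [le_div_iff₀ hd] at this
  rw [gridFloor]
  linarith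

theorem sub_gridFloor_nonneg {d : ℝ} (hd : 0 < d) (s : ℝ) : 0 ≤ s - gridFloor d s :=
  sub_nonneg.2 (gridFloor_le hd s)

theorem sub_gridFloor_lt {d : ℝ} (hd : 0 < d) (s : ℝ) : s - gridFloor d s < d := by
  have := Int.lt_floor_add_one (s / d)
  rw [div_lt_iff₀ hd] at this
  rw [gridFloor]
  linarith

theorem gridFloor_nonneg {d s : ℝ} (hd : 0 < d) (hs : 0 ≤ s) : 0 ≤ gridFloor d s :=
  mul_nonneg hd.le (by exact_mod_cast Int.floor_nonneg.2 (div_nonneg hs hd.le))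

theorem gridFloor_eq {d s : ℝ} (hd : 0 < d) {i : ℤ} (h1 : i * d ≤ s) (h2 : s < (i + 1) * d) :
    gridFloor d s = i * d := by
  have : ⌊s / d⌋ = i := Int.floor_eq_iff.2 ⟨(le_div_iff₀ hd).2 h1, (div_lt_iff₀ hd).2 h2⟩
  rw [gridFloor, this, mul_comm]

theorem le_gridFloor_of_gridFloor_lt {d s u : ℝ} (hd : 0 < d)
    (h : gridFloor d s < gridFloor d u) : s ≤ gridFloor d u := by
  have h1 : ⌊s / d⌋ + 1 ≤ ⌊u / d⌋ := by
    have := lt_of_mul_lt_mul_left h hd.le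
    exact_mod_cast this
  have h2 : d * ((⌊s / d⌋ : ℝ) + 1) ≤ gridFloor d u :=
    mul_le_mul_of_nonneg_left (by exact_mod_cast h1) hd.le
  have := sub_gridFloor_lt hd s
  rw [gridFloor] at this
  linarith

theorem abs_gridFloor_oscillation_le {d : ℝ} (hd : 0 < d) (s : ℝ) :
    |4 * d⁻¹ * (s - gridFloor d s) - 2| ≤ 2 := by
  have h1 := sub_gridFloor_nonneg hd s
  have h2 := sub_gridFloor_lt hd s
  have h3 : d⁻¹ * (s - gridFloor d s) ≤ 1 := by
    rw [inv_mul_eq_div, div_le_one hd]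
    exact h2.le
  have h4 : 0 ≤ d⁻¹ * (s - gridFloor d s) := by positivity
  rw [abs_le]
  constructor <;> linarith

theorem tendsto_gridFloor {Δ : ℕ → ℝ} (hΔpos : ∀ n, 0 < Δ n) (hΔ0 : Tendsto Δ atTop (nhds 0))
    (s : ℝ) : Tendsto (fun n => gridFloor (Δ n) s) atTop (nhds s) := by
  have h : Tendsto (fun n => s - gridFloor (Δ n) s) atTop (nhds 0) :=
    squeeze_zero (fun n => sub_gridFloor_nonneg (hΔpos n) s)
      (fun n => (sub_gridFloor_lt (hΔpos n) s).le) hΔ0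
  simpa using h.const_sub s

theorem intervalIntegrable_of_measurable_of_bound {h : ℝ → ℝ} {a b M : ℝ} (hab : a ≤ b)
    (hm : Measurable h) (hM : ∀ s ∈ Set.Ioc a b, |h s| ≤ M) :
    IntervalIntegrable h volume a b := by
  rw [intervalIntegrable_iff_integrableOn_Ioc_of_le hab]
  exact Measure.integrableOn_of_bounded (by simp) hm.aestronglyMeasurable
    ((ae_restrict_iff' measurableSet_Ioc).2 (ae_of_all _ fun s hs => hM s hs))

theorem integral_gridFloor_oscillation_block {d c y : ℝ} (hd : 0 < d) (f : ℝ → ℝ) (i : ℕ)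
    (hc : c = i * d) (hy : y ≤ (i + 1) * d) (hcy : c ≤ y) :
    ∫ s in c..y, f (gridFloor d s) * (4 * d⁻¹ * (s - gridFloor d s) - 2)
      = f c * (2 * d⁻¹ * (y - c) ^ 2 - 2 * (y - c)) := by
  have hae : ∀ᵐ s : ℝ ∂volume, s ≠ y := by
    simp [ae_iff]
  have hcongr : ∫ s in c..y, f (gridFloor d s) * (4 * d⁻¹ * (s - gridFloor d s) - 2)
      = ∫ s in c..y, f c * (4 * d⁻¹ * (s - c) - 2) := by
    refine intervalIntegral.integral_congr_ae ?_
    filter_upwards [hae] with s hsy hs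
    rw [Set.uIoc_of_le hcy] at hs
    have hlt : s < y := lt_of_le_of_ne hs.2 hsy
    have : gridFloor d s = c := by
      rw [hc]
      exact_mod_cast gridFloor_eq (i := (i : ℤ)) hd (by push_cast; linarith [hs.1])
        (by push_cast; linarith)
    rw [this]
  rw [hcongr, intervalIntegral.integral_const_mul]
  congr 1
  have hderiv (s : ℝ) : HasDerivAt (fun s => 2 * d⁻¹ * (s - c) ^ 2 - 2 * (s - c))
      (4 * d⁻¹ * (s - c) - 2) s := by
    have h1 : HasDerivAt (fun s : ℝ => s - c) 1 s := (hasDerivAt_id s).sub_const c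
    have h2 := ((h1.pow 2).const_mul (2 * d⁻¹)).sub (h1.const_mul 2)
    refine h2.congr_deriv ?_
    push_cast
    ring
  rw [intervalIntegral.integral_eq_sub_of_hasDerivAt (fun s _ => hderiv s)
    ((by fun_prop : Continuous fun s => 4 * d⁻¹ * (s - c) - 2).intervalIntegrable _ _)]
  simp

theorem abs_integral_gridFloor_oscillation_le {d t M : ℝ} (hd : 0 < d) (ht : 0 ≤ t) {f : ℝ → ℝ}
    (hf : Measurable f) (hM : ∀ s ∈ Set.Icc 0 t, |f s| ≤ M) :
    |∫ s in (0 : ℝ)..t, f (gridFloor d s) * (4 * d⁻¹ * (s - gridFloor d s) - 2)| ≤ 2 * M * d := by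
  set h : ℝ → ℝ := fun s => f (gridFloor d s) * (4 * d⁻¹ * (s - gridFloor d s) - 2) with hh
  set N := ⌊t / d⌋₊ with hN
  have hNt : N * d ≤ t := (le_div_iff₀ hd).1 (Nat.floor_le (div_nonneg ht hd.le))
  have htN : t < (N + 1) * d := (div_lt_iff₀ hd).1 (Nat.lt_floor_add_one _)
  have hM0 : 0 ≤ M := (abs_nonneg _).trans (hM 0 ⟨le_rfl, ht⟩)
  have hmeas : Measurable h :=
    (hf.comp (measurable_gridFloor d)).mul
      (((measurable_id.sub (measurable_gridFloor d)).const_mul _).sub_const _)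
  have hbd : ∀ s ∈ Set.Ioc 0 t, |h s| ≤ M * 2 := fun s hs => by
    rw [hh, abs_mul]
    exact mul_le_mul (hM _ ⟨gridFloor_nonneg hd hs.1.le, (gridFloor_le hd s).trans hs.2⟩)
      (abs_gridFloor_oscillation_le hd s)
      (abs_nonneg _) hM0
  have hint {b c : ℝ} (hb : 0 ≤ b) (hbc : b ≤ c) (hc : c ≤ t) : IntervalIntegrable h volume b c :=
    intervalIntegrable_of_measurable_of_bound hbc hmeas
      fun s hs => hbd s ⟨hb.trans_lt hs.1, hs.2.trans hc⟩
  have hblocks : ∫ s in (0 : ℝ)..(N * d), h s = 0 := by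
    have := intervalIntegral.sum_integral_adjacent_intervals (f := h) (μ := volume)
      (a := fun i : ℕ => (i : ℝ) * d) (n := N) (fun i hi => hint (by positivity)
        (by push_cast; nlinarith) (le_trans (by gcongr; exact_mod_cast hi) hNt))
    simp only [Nat.cast_zero, zero_mul] at this
    rw [← this]
    refine Finset.sum_eq_zero fun i _ => ?_
    rw [integral_gridFloor_oscillation_block hd f i rfl (by push_cast; rfl)
      (by push_cast; nlinarith)]
    push_cast
    field_simp
    ring
  rw [← intervalIntegral.integral_add_adjacent_intervals (hint le_rfl (by positivity) hNt)
    (hint (by positivity) hNt le_rfl), hblocks, zero_add]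
  have := intervalIntegral.norm_integral_le_of_norm_le_const (f := h) (a := N * d) (b := t)
    (C := M * 2) (fun s hs => by
      rw [Set.uIoc_of_le hNt] at hs
      exact hbd s ⟨lt_of_le_of_lt (by positivity) hs.1, hs.2⟩)
  rw [Real.norm_eq_abs, abs_of_nonneg (sub_nonneg.2 hNt)] at this
  refine this.trans ?_
  nlinarith

theorem tendsto_integral_gridFloor_weighted {Δ : ℕ → ℝ} (hΔpos : ∀ n, 0 < Δ n)
    (hΔ0 : Tendsto Δ atTop (nhds 0)) {t : ℝ} (ht : 0 ≤ t) {f : ℝ → ℝ} (hf : Continuous f) :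
    Tendsto (fun n => ∫ s in (0 : ℝ)..t,
        f (gridFloor (Δ n) s) * (4 * (Δ n)⁻¹ * (s - gridFloor (Δ n) s)))
      atTop (nhds (2 * ∫ s in (0 : ℝ)..t, f s)) := by
  obtain ⟨M, hM⟩ := (isCompact_Icc (a := (0 : ℝ)) (b := t)).exists_bound_of_continuousOn
    hf.continuousOn
  have hMr (n : ℕ) : ∀ s ∈ Set.Ioc 0 t, ‖f (gridFloor (Δ n) s)‖ ≤ M := fun s hs =>
    hM _ ⟨gridFloor_nonneg (hΔpos n) hs.1.le, (gridFloor_le (hΔpos n) s).trans hs.2⟩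
  have hmeas (n : ℕ) : Measurable fun s => f (gridFloor (Δ n) s) :=
    hf.measurable.comp (measurable_gridFloor _)
  have hosc : Tendsto (fun n => ∫ s in (0 : ℝ)..t,
      f (gridFloor (Δ n) s) * (4 * (Δ n)⁻¹ * (s - gridFloor (Δ n) s) - 2)) atTop (nhds 0) := by
    refine squeeze_zero_norm (fun n => abs_integral_gridFloor_oscillation_le (hΔpos n) ht
      hf.measurable hM) ?_
    simpa using hΔ0.const_mul (2 * M)
  have hstep : Tendsto (fun n => ∫ s in (0 : ℝ)..t, f (gridFloor (Δ n) s)) atTop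
      (nhds (∫ s in (0 : ℝ)..t, f s)) := by
    refine intervalIntegral.tendsto_integral_filter_of_dominated_convergence (fun _ => M)
      (.of_forall fun n => (hmeas n).aestronglyMeasurable) (.of_forall fun n => ae_of_all _ ?_)
      intervalIntegrable_const (ae_of_all _ fun s _ => ?_)
    · rw [Set.uIoc_of_le ht]
      exact hMr n
    · exact (hf.tendsto s).comp (tendsto_gridFloor hΔpos hΔ0 s)
  have hsum := hosc.add (hstep.const_mul 2)
  rw [zero_add] at hsum
  refine hsum.congr fun n => ?_
  have hint : IntervalIntegrable (fun s => f (gridFloor (Δ n) s)) volume 0 t :=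
    intervalIntegrable_of_measurable_of_bound ht (hmeas n) (hMr n)
  have hM0 : 0 ≤ M := (norm_nonneg _).trans (hM 0 ⟨le_rfl, ht⟩)
  have hint' : IntervalIntegrable (fun s => f (gridFloor (Δ n) s) *
      (4 * (Δ n)⁻¹ * (s - gridFloor (Δ n) s) - 2)) volume 0 t := by
    refine intervalIntegrable_of_measurable_of_bound ht ((hmeas n).mul
      (((measurable_id.sub (measurable_gridFloor (Δ n))).const_mul _).sub_const _))
      (M := M * 2) fun s hs => ?_
    rw [abs_mul]
    exact mul_le_mul (hMr n s hs) (abs_gridFloor_oscillation_le (hΔpos n) s) (abs_nonneg _) hM0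
  rw [← intervalIntegral.integral_const_mul, ← intervalIntegral.integral_add hint'
    (hint.const_mul 2)]
  congr 1 with s
  ring

theorem integrable_sq_sub_const_sq_gaussianReal (v : NNReal) (c : ℝ) :
    Integrable (fun x : ℝ => (x ^ 2 - c) ^ 2) (gaussianReal 0 v) := by
  have h4 : Integrable (fun x : ℝ => x ^ 4) (gaussianReal 0 v) := by
    have := (memLp_id_gaussianReal (μ := 0) (v := v) 4).integrable_norm_pow (by norm_num)
    simpa [Even.pow_abs (show Even 4 by decide)] using this
  have h2 : Integrable (fun x : ℝ => x ^ 2) (gaussianReal 0 v) :=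
    (memLp_id_gaussianReal (μ := 0) (v := v) 2).integrable_sq
  refine ((h4.sub (h2.const_mul (2 * c))).add (integrable_const (c ^ 2))).congr
    (ae_of_all _ fun x => ?_)
  simp only [Pi.add_apply, Pi.sub_apply]
  ring

theorem integral_sq_sub_variance_gaussianReal (v : NNReal) :
    ∫ x, (x ^ 2 - (v : ℝ)) ∂gaussianReal 0 v = 0 := by
  have h2 : Integrable (fun x : ℝ => x ^ 2) (gaussianReal 0 v) :=
    (memLp_id_gaussianReal (μ := 0) (v := v) 2).integrable_sq
  have hvar := variance_fun_id_gaussianReal (μ := 0) (v := v)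
  rw [variance_eq_integral (by fun_prop), integral_id_gaussianReal] at hvar
  rw [integral_sub h2 (integrable_const _)]
  simpa [sub_eq_zero] using hvar

theorem integral_sq_sub_variance_sq_gaussianReal (v : NNReal) :
    ∫ x, (x ^ 2 - (v : ℝ)) ^ 2 ∂gaussianReal 0 v
      = (v : ℝ) ^ 2 * ∫ x, (x ^ 2 - 1) ^ 2 ∂gaussianReal 0 1 := by
  have hmap : gaussianReal 0 v = (gaussianReal 0 1).map (√(v : ℝ) * ·) := by
    rw [gaussianReal_map_const_mul]
    congr 1
    · simp
    · ext
      simp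
  conv_lhs => rw [hmap]
  rw [integral_map (by fun_prop) (by fun_prop), ← integral_const_mul]
  congr 1 with x
  rw [mul_pow, Real.sq_sqrt v.coe_nonneg]
  ring

theorem tendstoInMeasure_add {Ω : Type*} {mΩ : MeasurableSpace Ω} {μ : Measure Ω}
    {X Y : ℕ → Ω → ℝ} {x y : Ω → ℝ} (hX : TendstoInMeasure μ X atTop x)
    (hY : TendstoInMeasure μ Y atTop y) :
    TendstoInMeasure μ (fun n ω => X n ω + Y n ω) atTop (fun ω => x ω + y ω) := by
  rw [tendstoInMeasure_iff_norm] at hX hY ⊢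
  intro ε hε
  have h := (hX (ε / 2) (half_pos hε)).add (hY (ε / 2) (half_pos hε))
  rw [add_zero] at h
  refine tendsto_of_tendsto_of_tendsto_of_le_of_le tendsto_const_nhds h (fun _ => zero_le)
    fun n => (measure_mono fun ω hω => ?_).trans (measure_union_le _ _)
  by_contra hcon
  simp only [Set.mem_union, Set.mem_ofPred_eq, not_or, not_le] at hcon hω
  have := norm_add_le (X n ω - x ω) (Y n ω - y ω)
  rw [sub_add_sub_comm] at this
  linarith [hcon.1, hcon.2]

theorem tendstoInMeasure_of_localization {Ω : Type*} {mΩ : MeasurableSpace Ω} {μ : Measure Ω}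
    {X : ℕ → Ω → ℝ} {x : Ω → ℝ} {X' : ℕ → ℕ → Ω → ℝ} {x' : ℕ → Ω → ℝ} {A : ℕ → Set Ω}
    (hA : Tendsto (fun N => μ (A N)) atTop (nhds 0))
    (hX' : ∀ N, TendstoInMeasure μ (X' N) atTop (x' N))
    (hX : ∀ N n, ∀ ω ∉ A N, X' N n ω = X n ω) (hx : ∀ N, ∀ ω ∉ A N, x' N ω = x ω) :
    TendstoInMeasure μ X atTop x := by
  intro ε hε
  rw [ENNReal.tendsto_atTop_zero]
  intro δ hδ
  have hδ2 : 0 < δ / 2 := ENNReal.half_pos hδ.ne'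
  obtain ⟨N, hN⟩ := ENNReal.tendsto_atTop_zero.1 hA (δ / 2) hδ2
  obtain ⟨n₀, hn₀⟩ := ENNReal.tendsto_atTop_zero.1 (hX' N ε hε) (δ / 2) hδ2
  refine ⟨n₀, fun n hn => ?_⟩
  calc μ {ω | ε ≤ edist (X n ω) (x ω)}
      ≤ μ (A N ∪ {ω | ε ≤ edist (X' N n ω) (x' N ω)}) := by
        refine measure_mono fun ω hω => ?_
        by_cases h : ω ∈ A N
        · exact Or.inl h
        · refine Or.inr ?_
          rw [Set.mem_ofPred_eq, hX N n ω h, hx N ω h]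
          exact hω
    _ ≤ δ / 2 + δ / 2 := (measure_union_le _ _).trans (add_le_add (hN N le_rfl) (hn₀ n hn))
    _ = δ := ENNReal.add_halves δ

/-- A continuous process is bounded on `[0, 1]` up to events of small probability. -/
theorem exists_tendsto_measure_zero_of_continuous {Ω : Type*} {mΩ : MeasurableSpace Ω}
    {μ : Measure Ω} [IsFiniteMeasure μ] {Y : ℝ → Ω → ℝ} (hYc : ∀ ω, Continuous fun s => Y s ω)
    (hYm : ∀ s, Measurable (Y s)) :
    ∃ A : ℕ → Set Ω, Tendsto (fun N => μ (A N)) atTop (nhds 0) ∧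
      ∀ N, ∀ ω ∉ A N, ∀ s ∈ Set.Icc (0 : ℝ) 1, Y s ω ≤ N := by
  set p : ℝ → ℝ := fun s => Set.projIcc (0 : ℝ) 1 zero_le_one s with hp
  have hpc : Continuous p := continuous_subtype_val.comp continuous_projIcc
  set A : ℕ → Set Ω := fun N => ⋃ q : ℚ, {ω | (N : ℝ) < Y (p q) ω} with hA
  have hout (N : ℕ) (ω : Ω) (hω : ω ∉ A N) (s : ℝ) : Y (p s) ω ≤ N := by
    have hclosed : IsClosed {s | Y (p s) ω ≤ N} :=
      isClosed_le ((hYc ω).comp hpc) continuous_const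
    refine Rat.denseRange_cast.induction_on s hclosed fun q => ?_
    simpa [hA] using fun h => hω (Set.mem_iUnion.2 ⟨q, h⟩)
  have hanti : Antitone A := fun N N' h =>
    Set.iUnion_mono fun q ω hω => by
      rw [Set.mem_ofPred_eq] at hω ⊢
      exact lt_of_le_of_lt (Nat.cast_le.2 h) hω
  have hempty : ⋂ N, A N = ∅ := by
    refine Set.eq_empty_of_forall_notMem fun ω hω => ?_
    obtain ⟨B, hB⟩ := (isCompact_Icc (a := (0 : ℝ)) (b := 1)).exists_bound_of_continuousOn
      (hYc ω).continuousOn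
    obtain ⟨N, hN⟩ := exists_nat_gt B
    obtain ⟨q, hq⟩ := Set.mem_iUnion.1 (Set.mem_iInter.1 hω N)
    have h1 : Y (p q) ω ≤ B := (le_abs_self _).trans (hB _ (Set.projIcc _ _ _ _).2)
    exact not_lt.2 (h1.trans hN.le) hq
  refine ⟨A, ?_, fun N ω hω s hs => ?_⟩
  · have := tendsto_measure_iInter_atTop (μ := μ) (s := A)
      (fun N => (MeasurableSet.iUnion fun q =>
        measurableSet_lt measurable_const (hYm _)).nullMeasurableSet) hanti
      ⟨0, measure_ne_top _ _⟩
    rwa [hempty, measure_empty] at this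
  · have := hout N ω hω s
    simpa only [hp, Set.projIcc_of_mem zero_le_one hs] using this

theorem integral_mul_sq_increment_sub_eq_zero {Ω : Type*} {m mΩ : MeasurableSpace Ω}
    {μ : Measure Ω} (hm : m ≤ mΩ) {D H : Ω → ℝ} {v : ℝ} (hv : 0 ≤ v) (hD : Measurable D)
    (hindep : Indep (MeasurableSpace.comap D inferInstance) m μ)
    (hgauss : μ.map D = gaussianReal 0 v.toNNReal) (hH : Measurable[m] H) :
    ∫ ω, H ω * (D ω ^ 2 - v) ∂μ = 0 := by
  have hφ : Measurable fun x : ℝ => x ^ 2 - v := by fun_prop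
  have hHD : IndepFun H (fun ω => D ω ^ 2 - v) μ :=
    ((IndepFun_iff_Indep D H μ).2 (indep_of_indep_of_le_right hindep hH.comap_le)).symm.comp
      measurable_id hφ
  have hzero : ∫ ω, (D ω ^ 2 - v) ∂μ = 0 := by
    have h := integral_sq_sub_variance_gaussianReal v.toNNReal
    rwa [Real.coe_toNNReal v hv, ← hgauss,
      integral_map hD.aemeasurable hφ.aestronglyMeasurable] at h
  have h := hHD.integral_mul_eq_mul_integral (hH.mono hm le_rfl).aestronglyMeasurable
    (hφ.comp hD).aestronglyMeasurable
  rw [hzero, mul_zero] at h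
  exact h

theorem integrable_sq_increment_sub_sq {Ω : Type*} {mΩ : MeasurableSpace Ω} {μ : Measure Ω}
    {D : Ω → ℝ} {v : ℝ} (hv : 0 ≤ v) (hD : Measurable D)
    (hgauss : μ.map D = gaussianReal 0 v.toNNReal) :
    Integrable (fun ω => (D ω ^ 2 - v) ^ 2) μ ∧
      ∫ ω, (D ω ^ 2 - v) ^ 2 ∂μ = v ^ 2 * ∫ x, (x ^ 2 - 1) ^ 2 ∂gaussianReal 0 1 := by
  constructor
  · have h := integrable_sq_sub_const_sq_gaussianReal v.toNNReal v
    rw [← hgauss, integrable_map_measure (by fun_prop) hD.aemeasurable] at h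
    exact h
  · have h := integral_sq_sub_variance_sq_gaussianReal v.toNNReal
    rw [Real.coe_toNNReal v hv, ← hgauss, integral_map hD.aemeasurable (by fun_prop)] at h
    exact h

/-- The squared increment of `W` over `[gridFloor d s, s]`, compensated by its mean, weighted by `g`
at the left grid point and divided by a quarter of the mesh size. -/
noncomputable def compensatedIncrement {Ω : Type*} (g : ℝ → ℝ) (W : ℝ → Ω → ℝ) (d : ℝ) (ω : Ω)
    (s : ℝ) : ℝ :=
  4 * d⁻¹ * (g (W (gridFloor d s) ω) *
    ((W s ω - W (gridFloor d s) ω) ^ 2 - (s - gridFloor d s)))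

theorem integral_sq_compensatedIncrement_le
    {Ω : Type*} {mΩ : MeasurableSpace Ω} {μ : Measure Ω} {W : ℝ → Ω → ℝ}
    (hWm : ∀ s, Measurable (W s))
    (hWgauss : ∀ s t : ℝ, 0 ≤ s → s ≤ t → t ≤ 1 →
      Measure.map (fun ω => W t ω - W s ω) μ = gaussianReal 0 (Real.toNNReal (t - s)))
    {g : ℝ → ℝ} (hg : Measurable g) {M : ℝ} (hM : ∀ x, |g x| ≤ M)
    {d s : ℝ} (hd : 0 < d) (hs : s ∈ Set.Icc (0 : ℝ) 1) :
    Integrable (fun ω => compensatedIncrement g W d ω s ^ 2) μ ∧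
      ∫ ω, compensatedIncrement g W d ω s ^ 2 ∂μ
        ≤ 16 * M ^ 2 * ∫ x, (x ^ 2 - 1) ^ 2 ∂gaussianReal 0 1 := by
  set κ : ℝ := ∫ x, (x ^ 2 - 1) ^ 2 ∂gaussianReal 0 1 with hκ
  have hκ0 : 0 ≤ κ := integral_nonneg fun x => sq_nonneg _
  have hr0 := gridFloor_nonneg hd hs.1
  have hrs := gridFloor_le hd s
  have hv := sub_gridFloor_nonneg hd s
  have hvd := sub_gridFloor_lt hd s
  have hD : Measurable fun ω => W s ω - W (gridFloor d s) ω :=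
    (hWm s).sub (hWm (gridFloor d s))
  obtain ⟨hI, hE⟩ := integrable_sq_increment_sub_sq (μ := μ) hv hD (hWgauss _ s hr0 hrs hs.2)
  have hpt (ω : Ω) : compensatedIncrement g W d ω s ^ 2 ≤ (4 * d⁻¹ * M) ^ 2 *
      ((W s ω - W (gridFloor d s) ω) ^ 2 - (s - gridFloor d s)) ^ 2 := by
    have hgM : g (W (gridFloor d s) ω) ^ 2 ≤ M ^ 2 :=
      sq_le_sq' (abs_le.1 (hM _)).1 (abs_le.1 (hM _)).2
    rw [compensatedIncrement, ← mul_assoc, mul_pow, mul_pow _ (g _), mul_pow _ M]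
    gcongr
  have hI' := hI.const_mul ((4 * d⁻¹ * M) ^ 2)
  have hZm : Measurable fun ω => compensatedIncrement g W d ω s :=
    ((hg.comp (hWm _)).mul ((hD.pow_const 2).sub_const _)).const_mul _
  have hZI : Integrable (fun ω => compensatedIncrement g W d ω s ^ 2) μ :=
    hI'.mono' (hZm.pow_const 2).aestronglyMeasurable (ae_of_all _ fun ω => by
      rw [Real.norm_of_nonneg (sq_nonneg _)]
      exact hpt ω)
  refine ⟨hZI, (integral_mono hZI hI' hpt).trans ?_⟩
  rw [integral_const_mul, hE]
  have hratio : (d⁻¹ * (s - gridFloor d s)) ^ 2 ≤ 1 := by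
    refine pow_le_one₀ (mul_nonneg (inv_nonneg.2 hd.le) hv) ?_
    rw [inv_mul_eq_div, div_le_one hd]
    exact hvd.le
  calc (4 * d⁻¹ * M) ^ 2 * ((s - gridFloor d s) ^ 2 * κ)
      = 16 * M ^ 2 * κ * (d⁻¹ * (s - gridFloor d s)) ^ 2 := by ring
    _ ≤ 16 * M ^ 2 * κ * 1 := by gcongr
    _ = 16 * M ^ 2 * κ := mul_one _

theorem integral_compensatedIncrement_mul_eq_zero
    {Ω : Type*} {mΩ : MeasurableSpace Ω} {μ : Measure Ω} {ℱ : Filtration ℝ mΩ} {W : ℝ → Ω → ℝ}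
    (hWad : Adapted ℱ W)
    (hWindep : ∀ s t : ℝ, 0 ≤ s → s ≤ t → t ≤ 1 →
      Indep (MeasurableSpace.comap (fun ω => W t ω - W s ω) inferInstance) (ℱ s) μ)
    (hWgauss : ∀ s t : ℝ, 0 ≤ s → s ≤ t → t ≤ 1 →
      Measure.map (fun ω => W t ω - W s ω) μ = gaussianReal 0 (Real.toNNReal (t - s)))
    {g : ℝ → ℝ} (hg : Measurable g) {d s u : ℝ} (hd : 0 < d) (hu : u ∈ Set.Icc (0 : ℝ) 1)
    (hsu : gridFloor d s < gridFloor d u) :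
    ∫ ω, compensatedIncrement g W d ω s * compensatedIncrement g W d ω u ∂μ = 0 := by
  set r := gridFloor d u with hr
  have hr0 : 0 ≤ r := gridFloor_nonneg hd hu.1
  have hWm (s : ℝ) : Measurable (W s) := (hWad s).mono (ℱ.le s) le_rfl
  have hWr {v : ℝ} (hv : v ≤ r) : Measurable[ℱ r] (W v) := (hWad v).mono (ℱ.mono hv) le_rfl
  have hsr : s ≤ r := le_gridFloor_of_gridFloor_lt hd hsu
  have hH : Measurable[ℱ r] fun ω =>
      compensatedIncrement g W d ω s * (4 * d⁻¹ * g (W r ω)) :=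
    (((hg.comp (hWr hsu.le)).mul
      ((((hWr hsr).sub (hWr hsu.le)).pow_const 2).sub_const _)).const_mul _).mul
      ((hg.comp (hWr le_rfl)).const_mul _)
  have h := integral_mul_sq_increment_sub_eq_zero (μ := μ) (ℱ.le r)
    (D := fun ω => W u ω - W r ω) (sub_gridFloor_nonneg hd u) ((hWm u).sub (hWm r))
    (hWindep r u hr0 (gridFloor_le hd u) hu.2)
    (hWgauss r u hr0 (gridFloor_le hd u) hu.2) hH
  rw [← h]
  congr 1 with ω
  rw [compensatedIncrement.eq_def g W d ω u, ← hr]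
  ring

theorem integral_weighted_sq_increment_eq_add {Ω : Type*} {W : ℝ → Ω → ℝ} {g : ℝ → ℝ}
    (hg : Measurable g) {M : ℝ} (hM : ∀ x, |g x| ≤ M) {ω : Ω}
    (hWc : Continuous fun s => W s ω) {d t : ℝ} (hd : 0 < d) (ht : 0 ≤ t) :
    4 * d⁻¹ * ∫ s in (0 : ℝ)..t, g (W (gridFloor d s) ω) * (W s ω - W (gridFloor d s) ω) ^ 2
      = (∫ s in (0 : ℝ)..t, compensatedIncrement g W d ω s)
        + ∫ s in (0 : ℝ)..t, g (W (gridFloor d s) ω) * (4 * d⁻¹ * (s - gridFloor d s)) := by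
  have hM0 : 0 ≤ M := (abs_nonneg _).trans (hM 0)
  obtain ⟨B, hB⟩ := (isCompact_Icc (a := (0 : ℝ)) (b := t)).exists_bound_of_continuousOn
    hWc.continuousOn
  have hgrid : Measurable fun s => W (gridFloor d s) ω :=
    hWc.measurable.comp (measurable_gridFloor d)
  have hmean : IntervalIntegrable
      (fun s => g (W (gridFloor d s) ω) * (4 * d⁻¹ * (s - gridFloor d s))) volume 0 t := by
    refine intervalIntegrable_of_measurable_of_bound ht
      ((hg.comp hgrid).mul ((measurable_id.sub (measurable_gridFloor d)).const_mul _))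
      (M := M * 4) fun s _ => ?_
    rw [abs_mul]
    have h := abs_le.1 (abs_gridFloor_oscillation_le hd s)
    exact mul_le_mul (hM _) (abs_le.2 ⟨by linarith [h.1], by linarith [h.2]⟩) (abs_nonneg _) hM0
  have hsq : IntervalIntegrable
      (fun s => g (W (gridFloor d s) ω) * (W s ω - W (gridFloor d s) ω) ^ 2) volume 0 t := by
    refine intervalIntegrable_of_measurable_of_bound ht
      ((hg.comp hgrid).mul ((hWc.measurable.sub hgrid).pow_const 2))
      (M := M * (B + B) ^ 2) fun s hs => ?_
    rw [abs_mul, abs_pow]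
    have h1 := hB s ⟨hs.1.le, hs.2⟩
    have h2 := hB _ ⟨gridFloor_nonneg hd hs.1.le, (gridFloor_le hd s).trans hs.2⟩
    have h3 : |W s ω - W (gridFloor d s) ω| ≤ B + B := (norm_sub_le _ _).trans (add_le_add h1 h2)
    have h4 := hM (W (gridFloor d s) ω)
    gcongr
  have hcomp : (fun s => compensatedIncrement g W d ω s) = fun s =>
      4 * d⁻¹ * (g (W (gridFloor d s) ω) * (W s ω - W (gridFloor d s) ω) ^ 2)
        - g (W (gridFloor d s) ω) * (4 * d⁻¹ * (s - gridFloor d s)) := by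
    funext s
    rw [compensatedIncrement]
    ring
  rw [hcomp, intervalIntegral.integral_sub (hsq.const_mul _) hmean, sub_add_cancel,
    intervalIntegral.integral_const_mul]

theorem tendstoInMeasure_weighted_sq_increments_of_bounded
    {Ω : Type*} {mΩ : MeasurableSpace Ω} (μ : Measure Ω) [IsProbabilityMeasure μ]
    (ℱ : Filtration ℝ mΩ) (W : ℝ → Ω → ℝ)
    (hWc : ∀ ω, Continuous fun t => W t ω)
    (hWad : Adapted ℱ W)
    (hWindep : ∀ s t : ℝ, 0 ≤ s → s ≤ t → t ≤ 1 →
      Indep (MeasurableSpace.comap (fun ω => W t ω - W s ω) inferInstance) (ℱ s) μ)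
    (hWgauss : ∀ s t : ℝ, 0 ≤ s → s ≤ t → t ≤ 1 →
      Measure.map (fun ω => W t ω - W s ω) μ = gaussianReal 0 (Real.toNNReal (t - s)))
    {Δ : ℕ → ℝ} (hΔpos : ∀ n, 0 < Δ n) (hΔ0 : Tendsto Δ atTop (nhds 0))
    {g : ℝ → ℝ} (hg : Continuous g) {M : ℝ} (hM : ∀ x, |g x| ≤ M)
    {t : ℝ} (ht : t ∈ Set.Icc (0 : ℝ) 1) :
    TendstoInMeasure μ
      (fun n ω => 4 * (Δ n)⁻¹ * ∫ s in (0 : ℝ)..t,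
        g (W (gridFloor (Δ n) s) ω) * (W s ω - W (gridFloor (Δ n) s) ω) ^ 2)
      atTop (fun ω => 2 * ∫ s in (0 : ℝ)..t, g (W s ω)) := by
  have hWm (s : ℝ) : Measurable (W s) := (hWad s).mono (ℱ.le s) le_rfl
  have hWjoint : Measurable fun q : Ω × ℝ => W q.2 q.1 :=
    (measurable_uncurry_of_continuous_of_measurable hWc hWm).comp measurable_swap
  have hWgrid (n : ℕ) : Measurable fun q : Ω × ℝ => W (gridFloor (Δ n) q.2) q.1 :=
    hWjoint.comp (measurable_fst.prodMk ((measurable_gridFloor _).comp measurable_snd))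
  set ν : Measure ℝ := volume.restrict (Set.Ioc 0 t) with hν
  have hνmem : ∀ᵐ s ∂ν, s ∈ Set.Icc (0 : ℝ) 1 :=
    (ae_restrict_mem measurableSet_Ioc).mono fun s hs => ⟨hs.1.le, hs.2.trans ht.2⟩
  have hZm (n : ℕ) : Measurable (Function.uncurry (compensatedIncrement g W (Δ n))) :=
    ((hg.measurable.comp (hWgrid n)).mul (((hWjoint.sub (hWgrid n)).pow_const 2).sub
      (measurable_snd.sub ((measurable_gridFloor _).comp measurable_snd)))).const_mul _
  have hVm (n : ℕ) : Measurable fun q : Ω × ℝ =>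
      g (W (gridFloor (Δ n) q.2) q.1) * (4 * (Δ n)⁻¹ * (q.2 - gridFloor (Δ n) q.2)) :=
    (hg.measurable.comp (hWgrid n)).mul
      ((measurable_snd.sub ((measurable_gridFloor _).comp measurable_snd)).const_mul _)
  have hoff : ∀ᵐ p ∂ν.prod ν, p.1 ≠ p.2 := by
    rw [Measure.ae_prod_iff_ae_ae (p := fun p => p.1 ≠ p.2) measurableSet_diagonal.compl]
    exact ae_of_all _ fun s => by simp [ae_iff]
  have hZ : TendstoInMeasure μ
      (fun n ω => ∫ s, compensatedIncrement g W (Δ n) ω s ∂ν) atTop 0 := by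
    have hsq (n : ℕ) {s : ℝ} (hs : s ∈ Set.Icc (0 : ℝ) 1) :=
      integral_sq_compensatedIncrement_le hWm hWgauss hg.measurable hM (hΔpos n) hs
    have horth (n : ℕ) {s u : ℝ} (hu : u ∈ Set.Icc (0 : ℝ) 1) :=
      integral_compensatedIncrement_mul_eq_zero (s := s) hWad hWindep hWgauss hg.measurable
        (hΔpos n) hu
    refine tendstoInMeasure_integral_of_asymptotically_orthogonal hZm
      (fun n => hνmem.mono fun s hs => (hsq n hs).1)
      (fun n => hνmem.mono fun s hs => (hsq n hs).2) ?_
    filter_upwards [hoff, Measure.quasiMeasurePreserving_fst.ae hνmem,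
      Measure.quasiMeasurePreserving_snd.ae hνmem] with p hp h1 h2
    rcases lt_or_gt_of_ne hp with h | h
    · filter_upwards [(tendsto_gridFloor hΔpos hΔ0 p.1).eventually_lt
        (tendsto_gridFloor hΔpos hΔ0 p.2) h] with n hn
      exact horth n h2 hn
    · filter_upwards [(tendsto_gridFloor hΔpos hΔ0 p.2).eventually_lt
        (tendsto_gridFloor hΔpos hΔ0 p.1) h] with n hn
      simp_rw [mul_comm (compensatedIncrement g W (Δ n) _ p.1)]
      exact horth n h1 hn
  have hV : TendstoInMeasure μ (fun n ω => ∫ s in (0 : ℝ)..t,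
      g (W (gridFloor (Δ n) s) ω) * (4 * (Δ n)⁻¹ * (s - gridFloor (Δ n) s))) atTop
      (fun ω => 2 * ∫ s in (0 : ℝ)..t, g (W s ω)) := by
    refine tendstoInMeasure_of_tendsto_ae (fun n => ?_) (ae_of_all _ fun ω =>
      tendsto_integral_gridFloor_weighted hΔpos hΔ0 ht.1 (hg.comp (hWc ω)))
    simp_rw [intervalIntegral.integral_of_le ht.1]
    exact (hVm n).stronglyMeasurable.integral_prod_right'.aestronglyMeasurable
  refine TendstoInMeasure.congr (fun n => ae_of_all _ fun ω => ?_) (ae_of_all _ fun ω => ?_)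
    (tendstoInMeasure_add hZ hV)
  · beta_reduce
    rw [integral_weighted_sq_increment_eq_add hg.measurable hM (hWc ω) (hΔpos n) ht.1,
      intervalIntegral.integral_of_le (f := compensatedIncrement g W (Δ n) ω) ht.1]
  · simp

/-- For a smooth function `a` with all derivatives of polynomial growth and every fixed
`t ∈ [0,1]`, the quadratic variation process
`Cₜⁿ = 4Δₙ⁻¹ ∫_0^t a²(W_{Δₙ⌊s/Δₙ⌋})(W_s - W_{Δₙ⌊s/Δₙ⌋})² ds`
converges in probability to `Cₜ = 2∫_0^t a²(W_s) ds`. -/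
theorem statement4
    {Ω : Type*} {mΩ : MeasurableSpace Ω} (μ : Measure Ω) [IsProbabilityMeasure μ]
    (ℱ : Filtration ℝ mΩ) (W : ℝ → Ω → ℝ)
    (hW0 : ∀ᵐ ω ∂μ, W 0 ω = 0)
    (hWc : ∀ ω, Continuous fun t => W t ω)
    (hWad : Adapted ℱ W)
    (hWindep : ∀ s t : ℝ, 0 ≤ s → s ≤ t → t ≤ 1 →
      Indep (MeasurableSpace.comap (fun ω => W t ω - W s ω) inferInstance) (ℱ s) μ)
    (hWgauss : ∀ s t : ℝ, 0 ≤ s → s ≤ t → t ≤ 1 →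
      Measure.map (fun ω => W t ω - W s ω) μ = gaussianReal 0 (Real.toNNReal (t - s)))
    (Δ : ℕ → ℝ) (k : ℕ → ℕ)
    (hΔpos : ∀ n, 0 < Δ n)
    (hΔ0 : Tendsto Δ atTop (nhds 0))
    (hΔk : ∀ n, (k n : ℝ) * Δ n = 1)
    (a : ℝ → ℝ)
    (haSmooth : ContDiff ℝ (⊤ : ℕ∞) a)
    (haGrowth : ∀ m : ℕ, ∃ K q : ℝ, ∀ x, |iteratedDeriv m a x| ≤ K * (1 + |x| ^ q))
    (t : ℝ) (ht : t ∈ Set.Icc (0:ℝ) 1) :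
    TendstoInMeasure μ
      (fun n ω => 4 * (Δ n)⁻¹ *
        ∫ s in (0:ℝ)..t,
          (a (W (Δ n * ↑⌊s / Δ n⌋) ω)) ^ 2 * (W s ω - W (Δ n * ↑⌊s / Δ n⌋) ω) ^ 2)
      atTop
      (fun ω => 2 * ∫ s in (0:ℝ)..t, (a (W s ω)) ^ 2) := by
  have ha : Continuous fun x => a x ^ 2 := haSmooth.continuous.pow 2
  obtain ⟨A, hA0, hA⟩ := exists_tendsto_measure_zero_of_continuous (μ := μ)
    (Y := fun s ω => a (W s ω) ^ 2) (fun ω => ha.comp (hWc ω))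
    (fun s => ha.measurable.comp ((hWad s).mono (ℱ.le s) le_rfl))
  have hmem {s : ℝ} (hs : s ∈ Set.uIoc 0 t) : s ∈ Set.Icc (0 : ℝ) 1 := by
    rw [Set.uIoc_of_le ht.1] at hs
    exact ⟨hs.1.le, hs.2.trans ht.2⟩
  refine tendstoInMeasure_of_localization hA0
    (fun N => tendstoInMeasure_weighted_sq_increments_of_bounded μ ℱ W hWc hWad hWindep hWgauss
      hΔpos hΔ0 (g := fun x => min (a x ^ 2) N) (ha.min continuous_const) (M := N)
      (fun x => ?_) ht) (fun N n ω hω => ?_) (fun N ω hω => ?_)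
  · rw [abs_of_nonneg (le_min (sq_nonneg _) (Nat.cast_nonneg _))]
    exact min_le_right _ _
  · congr 1
    refine intervalIntegral.integral_congr_ae (ae_of_all _ fun s hs => ?_)
    have hs' := hmem hs
    rw [min_eq_left (hA N ω hω (gridFloor (Δ n) s)
      ⟨gridFloor_nonneg (hΔpos n) hs'.1, (gridFloor_le (hΔpos n) s).trans hs'.2⟩)]
    rfl
  · congr 1
    refine intervalIntegral.integral_congr_ae (ae_of_all _ fun s hs => ?_)
    exact min_eq_left (hA N ω hω s (hmem hs))
end

section
/- Let p ∈ 2ℕ ∪ (11,∞) and let (U,V) be a centered jointly Gaussian vector with Var(U) = 1, Var(V) = 1/3 and Cov(U,V) = 1/2. Set m_q := E[|Z|^q] for a standard normal Z. Then for all x₁, x₂, x₅ ∈ ℝ: E[ U · p·sgn(x₂U)|x₂U|^{p−1} · ( x₁ + (1/2) x₅ (U² − 1) ) − p m_p sgn(x₂)|x₂|^{p−1} x₅ U V ] = p · sgn(x₂)|x₂|^{p−1} · ( x₁ m_p + (1/2) x₅ (m_{p+2} − 2 m_p) ). -/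
open MeasureTheory ProbabilityTheory Filter

/-- The absolute moment `m_q = E[|Z|^q]` of a standard normal random variable. -/
noncomputable def absMoment (q : ℝ) : ℝ :=
  ∫ x, |x| ^ q ∂(gaussianReal 0 1)

/-- The centered bivariate Gaussian measure on `ℝ²` with covariance matrix
`[[1, 1/2], [1/2, 1/3]]`, given by its density
`(√3/π)·exp(-(2u² - 6uv + 6v²))` with respect to Lebesgue measure. -/
noncomputable def biGauss : Measure (ℝ × ℝ) :=
  (volume : Measure (ℝ × ℝ)).withDensity fun x =>
    ENNReal.ofReal (Real.sqrt 3 / Real.pi *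
      Real.exp (-(2 * x.1 ^ 2 - 6 * x.1 * x.2 + 6 * x.2 ^ 2)))

lemma biGauss_eq_map_shear :
    biGauss = ((gaussianReal 0 1).prod (gaussianReal 0 (1 / 12))).map
      (fun z : ℝ × ℝ => (z.1, z.1 / 2 + z.2)) := by
  have hS : Measurable (fun z : ℝ × ℝ => (z.1, z.1 / 2 + z.2)) := by fun_prop
  have hpres : MeasurePreserving (fun z : ℝ × ℝ => (z.1, z.1 / 2 + z.2))
      (volume : Measure (ℝ × ℝ)) volume :=
    MeasurePreserving.skew_product (g := fun x y => x / 2 + y) (MeasurePreserving.id volume)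
      (by fun_prop) (ae_of_all _ fun x => map_add_left_eq_self volume (x / 2))
  have hd : Measurable fun x : ℝ × ℝ => ENNReal.ofReal (Real.sqrt 3 / Real.pi *
      Real.exp (-(2 * x.1 ^ 2 - 6 * x.1 * x.2 + 6 * x.2 ^ 2))) := by fun_prop
  rw [gaussianReal_of_var_ne_zero _ one_ne_zero,
    gaussianReal_of_var_ne_zero _ (by norm_num : (1 / 12 : NNReal) ≠ 0),
    prod_withDensity (measurable_gaussianPDF _ _) (measurable_gaussianPDF _ _)]
  refine Measure.ext_of_lintegral _ fun f hf => ?_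
  rw [lintegral_map hf hS, biGauss, lintegral_withDensity_eq_lintegral_mul _ hd hf,
    lintegral_withDensity_eq_lintegral_mul _ (by fun_prop)
      (g := fun z : ℝ × ℝ => f (z.1, z.1 / 2 + z.2)) (hf.comp hS),
    ← hpres.lintegral_comp (hd.mul hf)]
  refine lintegral_congr fun z => ?_
  simp only [Pi.mul_apply, gaussianPDF]
  rw [← ENNReal.ofReal_mul (gaussianPDFReal_nonneg _ _ _)]
  congr 2
  simp only [gaussianPDFReal, NNReal.coe_one, NNReal.coe_div, NNReal.coe_ofNat]
  have hconst : (√(2 * Real.pi * 1))⁻¹ * (√(2 * Real.pi * (1 / 12)))⁻¹ = √3 / Real.pi := by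
    rw [← mul_inv, ← Real.sqrt_mul (by positivity),
      show 2 * Real.pi * 1 * (2 * Real.pi * (1 / 12)) = Real.pi ^ 2 / 3 by ring,
      Real.sqrt_div (by positivity), Real.sqrt_sq Real.pi_pos.le, inv_div]
  rw [mul_mul_mul_comm, hconst, ← Real.exp_add]
  congr 2
  ring

lemma integrable_abs_rpow_gaussianReal {q : ℝ} (hq : 0 < q) :
    Integrable (fun x : ℝ => |x| ^ q) (gaussianReal 0 1) := by
  have h := (memLp_id_gaussianReal (μ := 0) (v := 1) q.toNNReal).integrable_norm_rpow
    (by simpa using hq) ENNReal.coe_ne_top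
  simpa [Real.coe_toNNReal _ hq.le] using h

lemma integrable_id_gaussianReal (v : NNReal) :
    Integrable (fun x : ℝ => x) (gaussianReal 0 v) :=
  (memLp_id_gaussianReal (μ := 0) (v := v) 1).integrable (by simp)

lemma integral_sq_gaussianReal : ∫ x, x ^ 2 ∂(gaussianReal 0 1) = 1 := by
  have h := variance_fun_id_gaussianReal (μ := 0) (v := 1)
  rw [variance_eq_integral (by fun_prop)] at h
  simpa using h

lemma mul_sign_mul_abs_rpow {p : ℝ} (hp : p ≠ 0) (x u : ℝ) :
    u * (Real.sign (x * u) * |x * u| ^ (p - 1)) = Real.sign x * |x| ^ (p - 1) * |u| ^ p := by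
  rcases eq_or_ne u 0 with rfl | hu
  · simp [hp]
  have hsign : u * Real.sign (x * u) = Real.sign x * |u| := by
    rcases hu.lt_or_gt with hu | hu <;> rcases lt_trichotomy x 0 with hx | rfl | hx <;>
      simp [Real.sign_of_pos, Real.sign_of_neg, mul_pos_of_neg_of_neg, mul_neg_of_neg_of_pos,
        mul_neg_of_pos_of_neg, abs_of_pos, abs_of_neg, *]
  rw [abs_mul, Real.mul_rpow (abs_nonneg _) (abs_nonneg _), ← mul_assoc, hsign,
    Real.rpow_sub_one (abs_ne_zero.mpr hu) p]
  have := abs_ne_zero.mpr hu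
  field_simp

/-- For `p ∈ 2ℕ ∪ (11,∞)` and `(U,V)` centered jointly Gaussian with `Var(U)=1`,
`Var(V)=1/3`, `Cov(U,V)=1/2`,
`E[U·p·sgn(x₂U)|x₂U|^{p-1}(x₁ + ½x₅(U²-1)) - p m_p sgn(x₂)|x₂|^{p-1} x₅ U V]
 = p·sgn(x₂)|x₂|^{p-1}(x₁ m_p + ½x₅(m_{p+2} - 2m_p))`. -/
theorem statement8 (p : ℝ)
    (hp : (∃ m : ℕ, 0 < m ∧ p = 2 * m) ∨ 11 < p)
    {Ω : Type*} {mΩ : MeasurableSpace Ω} (μ : Measure Ω) [IsProbabilityMeasure μ]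
    (U V : Ω → ℝ)
    (hUV : Measure.map (fun ω => (U ω, V ω)) μ = biGauss)
    (x₁ x₂ x₅ : ℝ) :
    ∫ ω,
        (U ω * (p * Real.sign (x₂ * U ω) * |x₂ * U ω| ^ (p - 1))
            * (x₁ + (1 / 2) * x₅ * ((U ω) ^ 2 - 1))
          - p * absMoment p * Real.sign x₂ * |x₂| ^ (p - 1) * x₅ * U ω * V ω) ∂μ
      = p * Real.sign x₂ * |x₂| ^ (p - 1)
          * (x₁ * absMoment p + (1 / 2) * x₅ * (absMoment (p + 2) - 2 * absMoment p)) := by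
  have hp0 : 0 < p := by
    rcases hp with ⟨m, hm, rfl⟩ | hp
    · positivity
    · linarith
  set s := Real.sign x₂ * |x₂| ^ (p - 1) with hs
  set ν := (gaussianReal 0 1).prod (gaussianReal 0 (1 / 12)) with hν
  have hS : Measurable (fun z : ℝ × ℝ => (z.1, z.1 / 2 + z.2)) := by fun_prop
  have hprob : IsProbabilityMeasure biGauss := by
    rw [biGauss_eq_map_shear]
    exact Measure.isProbabilityMeasure_map hS.aemeasurable
  have hmeas : AEMeasurable (fun ω => (U ω, V ω)) μ := by
    by_contra h
    rw [Measure.map_of_not_aemeasurable h] at hUV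
    exact hprob.ne_zero _ hUV.symm
  set F : ℝ × ℝ → ℝ := fun z => p * s * (x₁ - x₅ / 2) * |z.1| ^ p
    + p * s * x₅ / 2 * |z.1| ^ (p + 2) - p * absMoment p * s * x₅ * (z.1 * z.2) with hF
  have hFm : Measurable F := by fun_prop
  have hpt : ∀ ω, U ω * (p * Real.sign (x₂ * U ω) * |x₂ * U ω| ^ (p - 1))
            * (x₁ + (1 / 2) * x₅ * ((U ω) ^ 2 - 1))
          - p * absMoment p * Real.sign x₂ * |x₂| ^ (p - 1) * x₅ * U ω * V ω
      = F (U ω, V ω) := by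
    intro ω
    have h1 := mul_sign_mul_abs_rpow hp0.ne' x₂ (U ω)
    have h2 : |U ω| ^ (p + 2) = |U ω| ^ p * U ω ^ 2 := by
      rw [Real.rpow_add_of_nonneg (abs_nonneg _) hp0.le zero_le_two, Real.rpow_two, sq_abs]
    simp only [hF, hs, h2]
    linear_combination p * (x₁ + (1 / 2) * x₅ * ((U ω) ^ 2 - 1)) * h1
  simp_rw [hpt]
  rw [← integral_map hmeas hFm.aestronglyMeasurable, hUV, biGauss_eq_map_shear,
    integral_map hS.aemeasurable hFm.aestronglyMeasurable]
  have hsq : Integrable (fun x : ℝ => x ^ 2) (gaussianReal 0 1) :=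
    (memLp_id_gaussianReal (μ := 0) (v := 1) 2).integrable_sq
  have i1 := (integrable_abs_rpow_gaussianReal hp0).comp_fst (gaussianReal 0 (1 / 12))
  have i2 := (integrable_abs_rpow_gaussianReal (by linarith : 0 < p + 2)).comp_fst
    (gaussianReal 0 (1 / 12))
  have i3 := hsq.comp_fst (gaussianReal 0 (1 / 12))
  have i4 := (integrable_id_gaussianReal 1).mul_prod (integrable_id_gaussianReal (1 / 12))
  have e1 : ∫ z, |z.1| ^ p ∂ν = absMoment p := by
    simp [hν, integral_fun_fst (μ := gaussianReal 0 1) (fun x : ℝ => |x| ^ p), absMoment]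
  have e2 : ∫ z, |z.1| ^ (p + 2) ∂ν = absMoment (p + 2) := by
    simp [hν, integral_fun_fst (μ := gaussianReal 0 1) (fun x : ℝ => |x| ^ (p + 2)), absMoment]
  have e3 : ∫ z, z.1 ^ 2 ∂ν = 1 := by
    simp [hν, integral_fun_fst (μ := gaussianReal 0 1) (fun x : ℝ => x ^ 2),
      integral_sq_gaussianReal]
  have e4 : ∫ z, z.1 * z.2 ∂ν = 0 := by
    rw [hν, integral_prod_mul (fun x : ℝ => x) (fun x : ℝ => x)]
    simp
  have hFS : ∀ z : ℝ × ℝ, F (z.1, z.1 / 2 + z.2) = p * s * (x₁ - x₅ / 2) * |z.1| ^ p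
      + p * s * x₅ / 2 * |z.1| ^ (p + 2) - (p * absMoment p * s * x₅ / 2 * z.1 ^ 2
      + p * absMoment p * s * x₅ * (z.1 * z.2)) := by
    intro z
    simp only [hF]
    ring
  simp_rw [hFS]
  rw [integral_sub (by exact (i1.const_mul _).add (i2.const_mul _))
      (by exact (i3.const_mul _).add (i4.const_mul _)),
    integral_add (i1.const_mul _) (i2.const_mul _), integral_add (i3.const_mul _) (i4.const_mul _)]
  simp only [← hν, integral_const_mul, e1, e2, e3, e4]
  rw [hs]
  ring
end

section
/- Let g : ℝ → ℝ be a polynomial and let κ : ℝ → ℝ be a C² function vanishing outside [ε₀, ∞) for some ε₀ > 0 and decaying, together with its derivatives, faster than any polynomial at infinity. Then ∫_0^∞ ∫_ℝ g(z/√x) · ( −∂_z [ φ(z;0,x) κ(x) ] ) dz dx = ( ∫_0^∞ x^{−1/2} κ(x) dx ) · ( ∫_ℝ g(y) · y · φ(y;0,1) dy ), where φ(z;0,x) = (2πx)^{−1/2} exp(−z²/(2x)). -/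
open MeasureTheory Filter

/-- The centered normal density `φ(z;0,x) = (2πx)^{-1/2} exp(-z²/(2x))`. -/
noncomputable def normDens (z x : ℝ) : ℝ :=
  (Real.sqrt (2 * Real.pi * x))⁻¹ * Real.exp (-(z ^ 2) / (2 * x))

theorem deriv_normDens_mul_const {x : ℝ} (hx : 0 < x) (c z : ℝ) :
    deriv (fun z' => normDens z' x * c) z = -(z / x * normDens z x * c) := by
  have hexp : HasDerivAt (fun z' : ℝ => -(z' ^ 2) / (2 * x)) (-(2 * z) / (2 * x)) z := by
    simpa using ((hasDerivAt_pow 2 z).neg).div_const (2 * x)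
  have h := ((hexp.exp.const_mul (Real.sqrt (2 * Real.pi * x))⁻¹).mul_const c).deriv
  unfold normDens
  rw [h]
  field_simp

theorem normDens_eq_scaled {x : ℝ} (hx : 0 < x) (z : ℝ) :
    normDens z x = (Real.sqrt x)⁻¹ * normDens (z / Real.sqrt x) 1 := by
  unfold normDens
  rw [Real.sqrt_mul (by positivity), div_pow, Real.sq_sqrt hx.le, mul_inv, mul_one, mul_one,
    show -(z ^ 2) / (2 * x) = -(z ^ 2 / x) / 2 by field_simp]
  ring

theorem integral_comp_div_sqrt_mul_neg_deriv_normDens (g : ℝ → ℝ) {x : ℝ} (hx : 0 < x) (c : ℝ) :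
    ∫ z, g (z / Real.sqrt x) * (-(deriv (fun z' => normDens z' x * c) z))
      = x ^ (-(1:ℝ)/2) * c * ∫ y, g y * y * normDens y 1 := by
  have hs : 0 < Real.sqrt x := Real.sqrt_pos.2 hx
  have hpow : x ^ (-(1:ℝ)/2) = (Real.sqrt x)⁻¹ := by
    rw [neg_div, Real.rpow_neg hx.le, Real.sqrt_eq_rpow]
  have hint : ∀ z, g (z / Real.sqrt x) * (-(deriv (fun z' => normDens z' x * c) z))
      = x⁻¹ * c *
        (fun y => g y * y * normDens y 1) (z / Real.sqrt x) := by
    intro z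
    have hz : z / x = z / Real.sqrt x / Real.sqrt x := by
      rw [div_div, Real.mul_self_sqrt hx.le]
    have hxinv : x⁻¹ = (Real.sqrt x)⁻¹ * (Real.sqrt x)⁻¹ := by
      rw [← mul_inv, Real.mul_self_sqrt hx.le]
    rw [deriv_normDens_mul_const hx, normDens_eq_scaled hx, hz, hxinv]
    ring
  simp_rw [hint]
  rw [integral_const_mul,
    Measure.integral_comp_div (fun y => g y * y * normDens y 1), abs_of_pos hs, smul_eq_mul, hpow]
  have hcancel : x⁻¹ * Real.sqrt x = (Real.sqrt x)⁻¹ := by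
    nth_rewrite 1 [← Real.mul_self_sqrt hx.le]
    field_simp
  rw [← hcancel]
  ring

/-- For a polynomial `g` and a `C²` function `κ` vanishing outside `[ε₀,∞)` (`ε₀ > 0`) and
rapidly decaying together with its derivatives,
`∫_0^∞ ∫_ℝ g(z/√x)(-∂_z[φ(z;0,x)κ(x)]) dz dx
 = (∫_0^∞ x^{-1/2} κ(x) dx)(∫_ℝ g(y) y φ(y;0,1) dy)`. -/
theorem statement11 (P : Polynomial ℝ) (κ : ℝ → ℝ) (ε₀ : ℝ) (hε₀ : 0 < ε₀)
    (hκsupp : ∀ x < ε₀, κ x = 0)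
    (hκC2 : ContDiff ℝ 2 κ)
    (hκdecay : ∀ j ≤ 2, ∀ q : ℕ,
      Tendsto (fun x => x ^ q * iteratedDeriv j κ x) atTop (nhds 0)) :
    ∫ x in Set.Ioi (0:ℝ),
        (∫ z, P.eval (z / Real.sqrt x) * (-(deriv (fun z' => normDens z' x * κ x) z)))
      = (∫ x in Set.Ioi (0:ℝ), x ^ (-(1:ℝ)/2) * κ x)
          * ∫ y, P.eval y * y * normDens y 1 := by
  rw [← integral_mul_const]
  exact setIntegral_congr_fun measurableSet_Ioi fun x hx =>
    integral_comp_div_sqrt_mul_neg_deriv_normDens (fun y => P.eval y) hx (κ x)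
end

section
/- Let g : ℝ → ℝ be a polynomial and let κ : ℝ → ℝ be a C² function vanishing outside [ε₀, ∞) for some ε₀ > 0 and decaying, together with its derivatives, faster than any polynomial at infinity. Then − ∫_0^∞ ∫_ℝ z · g(z/√x) · ∂_x [ φ(z;0,x) κ(x) ] dz dx = (1/2) ( ∫_0^∞ x^{−1/2} κ(x) dx ) · ( ∫_ℝ g(y) (2y − y³) φ(y;0,1) dy ), where φ(z;0,x) = (2πx)^{−1/2} exp(−z²/(2x)). -/
open MeasureTheory Filter

lemma integrable_polynomial_mul_normDens (P : Polynomial ℝ) :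
    Integrable (fun y => P.eval y * normDens y 1) := by
  have monomial (n : ℕ) : Integrable (fun y : ℝ => y ^ n * Real.exp (-(1 / 2) * y ^ 2)) := by
    have h := integrable_rpow_mul_exp_neg_mul_sq (b := 1 / 2) (by norm_num) (s := n)
      (lt_of_lt_of_le (by norm_num) n.cast_nonneg)
    simpa only [Real.rpow_natCast] using h
  induction P using Polynomial.induction_on' with
  | add p q hp hq =>
    simp only [Polynomial.eval_add, add_mul]
    exact hp.add hq
  | monomial n a =>
    refine ((monomial n).const_mul (a * (Real.sqrt (2 * Real.pi * 1))⁻¹)).congr (.of_forall ?_)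
    intro y
    simp only [normDens, Polynomial.eval_monomial]
    rw [show -(y ^ 2) / (2 * 1) = -(1 / 2) * y ^ 2 by ring]
    ring

lemma normDens_sqrt_mul (y : ℝ) {x : ℝ} (hx : 0 < x) :
    normDens (Real.sqrt x * y) x = (Real.sqrt x)⁻¹ * normDens y 1 := by
  have h : -((Real.sqrt x * y) ^ 2) / (2 * x) = -(y ^ 2) / (2 * 1) := by
    rw [mul_pow, Real.sq_sqrt hx.le]
    field_simp
  simp only [normDens]
  rw [h, Real.sqrt_mul (by positivity) x, mul_one, mul_inv]
  ring_nf

lemma hasDerivAt_normDens (z : ℝ) {x : ℝ} (hx : 0 < x) :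
    HasDerivAt (normDens z) (normDens z x * (z ^ 2 / (2 * x ^ 2) - 1 / (2 * x))) x := by
  have hpos : 0 < 2 * Real.pi * x := by positivity
  have h₁ : HasDerivAt (fun x : ℝ => 2 * Real.pi * x) (2 * Real.pi) x := by
    simpa using (hasDerivAt_id x).const_mul (2 * Real.pi)
  have h₂ : HasDerivAt (fun x : ℝ => 2 * x) 2 x := by
    simpa using (hasDerivAt_id x).const_mul (2 : ℝ)
  have h := ((h₁.sqrt hpos.ne').inv (Real.sqrt_ne_zero'.2 hpos)).mul
    (((hasDerivAt_const x (-(z ^ 2))).div h₂ (by positivity)).exp)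
  refine h.congr_deriv ?_
  have hs := Real.sqrt_ne_zero'.2 hpos
  simp only [normDens, Pi.inv_apply, Pi.div_apply]
  rw [Real.sq_sqrt hpos.le]
  field_simp
  ring

lemma integral_mul_deriv_normDens_mul (P : Polynomial ℝ) {κ : ℝ → ℝ} {κ' x : ℝ} (hx : 0 < x)
    (hκ : HasDerivAt κ κ' x) :
    ∫ z, z * P.eval (z / Real.sqrt x) * deriv (fun x' => normDens z x' * κ x') x
      = (x ^ (-(1 : ℝ) / 2) * κ x) * (1 / 2)
          * ((∫ y, (Polynomial.X ^ 3 * P).eval y * normDens y 1)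
            - ∫ y, (Polynomial.X * P).eval y * normDens y 1)
        + (x ^ ((1 : ℝ) / 2) * κ') * ∫ y, (Polynomial.X * P).eval y * normDens y 1 := by
  have hs : 0 < Real.sqrt x := Real.sqrt_pos.2 hx
  have hsq : Real.sqrt x ^ 2 = x := Real.sq_sqrt hx.le
  have hA := integrable_polynomial_mul_normDens (Polynomial.X * P)
  have hB := integrable_polynomial_mul_normDens (Polynomial.X ^ 3 * P)
  obtain ⟨G, hG⟩ : ∃ G : ℝ → ℝ, G = fun y =>
      κ x / (2 * x) * ((Polynomial.X ^ 3 * P).eval y * normDens y 1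
        - (Polynomial.X * P).eval y * normDens y 1)
      + κ' * ((Polynomial.X * P).eval y * normDens y 1) := ⟨_, rfl⟩
  have hGint : ∫ y, G y = κ x / (2 * x)
        * ((∫ y, (Polynomial.X ^ 3 * P).eval y * normDens y 1)
          - ∫ y, (Polynomial.X * P).eval y * normDens y 1)
      + κ' * ∫ y, (Polynomial.X * P).eval y * normDens y 1 := by
    rw [hG, ← integral_sub hB hA, ← integral_const_mul, ← integral_const_mul]
    exact integral_add ((hB.sub hA).const_mul _) (hA.const_mul _)
  have key (z : ℝ) :
      z * P.eval (z / Real.sqrt x) * deriv (fun x' => normDens z x' * κ x') x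
        = G (z / Real.sqrt x) := by
    obtain ⟨y, rfl⟩ : ∃ y, z = Real.sqrt x * y := ⟨z / Real.sqrt x, by field_simp⟩
    rw [((hasDerivAt_normDens _ hx).fun_mul hκ).deriv, normDens_sqrt_mul y hx,
      mul_div_cancel_left₀ y hs.ne', hG]
    simp only [Polynomial.eval_mul, Polynomial.eval_pow, Polynomial.eval_X]
    rw [mul_pow, hsq]
    field_simp
  have hneg : x ^ (-(1 : ℝ) / 2) = (Real.sqrt x)⁻¹ := by
    rw [neg_div, Real.rpow_neg hx.le, Real.sqrt_eq_rpow]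
  simp_rw [key]
  rw [Measure.integral_comp_div, abs_of_pos hs, smul_eq_mul, hGint, hneg, ← Real.sqrt_eq_rpow]
  have : κ x / (2 * x) = κ x / (2 * Real.sqrt x ^ 2) := by rw [hsq]
  rw [this]
  field_simp

lemma integrableOn_Ioi_rpow_mul_of_rapid_decay {h : ℝ → ℝ} {ε r : ℝ} (hε : 0 < ε)
    (hsupp : ∀ x < ε, h x = 0) (hcont : Continuous h) (hr : r ≤ 1)
    (hdecay : Tendsto (fun x => x ^ 3 * h x) atTop (nhds 0)) :
    IntegrableOn (fun x => x ^ r * h x) (Set.Ioi 0) := by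
  have hsplit : Set.Ioi (0 : ℝ) = Set.Ioo 0 ε ∪ Set.Ici ε := by
    rw [Set.Ioo_union_Ici_eq_Ioi hε]
  rw [hsplit]
  refine IntegrableOn.union ?_ ?_
  · refine integrableOn_zero.congr_fun (fun x hx => ?_) measurableSet_Ioo
    simp [hsupp x hx.2]
  · have hloc : LocallyIntegrableOn (fun x => x ^ r * h x) (Set.Ici ε) := by
      refine ContinuousOn.locallyIntegrableOn (fun x hx => ?_) measurableSet_Ici
      exact ((Real.continuousAt_rpow_const x r
        (Or.inl (hε.trans_le hx).ne')).mul hcont.continuousAt).continuousWithinAt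
    refine hloc.integrableOn_of_isBigO_atTop (g := fun x => x ^ (-2 : ℝ)) ?_
      ⟨Set.Ioi 1, Ioi_mem_atTop 1, integrableOn_Ioi_rpow_of_lt (by norm_num) one_pos⟩
    refine Asymptotics.IsBigO.of_bound 1 ?_
    filter_upwards [Ioi_mem_atTop 1, hdecay.abs.eventually (gt_mem_nhds (by simp : |(0 : ℝ)| < 1))]
      with x hx hx'
    have hx : 1 < x := hx
    have hx0 : 0 < x := by linarith
    rw [abs_mul, abs_of_pos (by positivity : 0 < x ^ 3)] at hx'
    have hxr : x ^ r ≤ x := by simpa using Real.rpow_le_rpow_of_exponent_le hx.le hr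
    rw [Real.norm_eq_abs, Real.norm_eq_abs, abs_mul, abs_of_pos (Real.rpow_pos_of_pos hx0 _),
      abs_of_pos (Real.rpow_pos_of_pos hx0 _), Real.rpow_neg hx0.le, one_mul]
    norm_cast
    rw [← one_div, le_div_iff₀ (by positivity)]
    nlinarith [mul_le_mul_of_nonneg_right hxr (by positivity : 0 ≤ |h x| * x ^ 2)]

lemma integral_Ioi_rpow_half_mul_deriv {κ : ℝ → ℝ} (hκ : Differentiable ℝ κ)
    (hzero : κ 0 = 0)
    (hdecay : Tendsto (fun x => x ^ 1 * κ x) atTop (nhds 0))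
    (hint : IntegrableOn (fun x => x ^ (-(1 : ℝ) / 2) * κ x) (Set.Ioi 0))
    (hint' : IntegrableOn (fun x => x ^ ((1 : ℝ) / 2) * deriv κ x) (Set.Ioi 0)) :
    ∫ x in Set.Ioi (0 : ℝ), x ^ ((1 : ℝ) / 2) * deriv κ x
      = -(1 / 2) * ∫ x in Set.Ioi (0 : ℝ), x ^ (-(1 : ℝ) / 2) * κ x := by
  have hder : ∀ x ∈ Set.Ioi (0 : ℝ), HasDerivAt (fun x => x ^ ((1 : ℝ) / 2) * κ x)
      (1 / 2 * (x ^ (-(1 : ℝ) / 2) * κ x) + x ^ ((1 : ℝ) / 2) * deriv κ x) x := by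
    intro x hx
    refine ((Real.hasDerivAt_rpow_const (p := 1 / 2)
      (Or.inl (ne_of_gt hx))).fun_mul (hκ x).hasDerivAt).congr_deriv ?_
    rw [show (1 : ℝ) / 2 - 1 = -1 / 2 by norm_num]
    ring
  have hlim : Tendsto (fun x : ℝ => x ^ ((1 : ℝ) / 2) * κ x) atTop (nhds 0) := by
    refine squeeze_zero_norm' ?_ (by simpa using hdecay.norm)
    filter_upwards [Ioi_mem_atTop 1] with x hx
    have hx : 1 < x := hx
    have hx0 : 0 ≤ x := by linarith
    have hxr : x ^ ((1 : ℝ) / 2) ≤ x := by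
      simpa using Real.rpow_le_rpow_of_exponent_le hx.le (by norm_num : (1 : ℝ) / 2 ≤ 1)
    rw [norm_mul, Real.norm_of_nonneg (Real.rpow_nonneg hx0 _), ← Real.norm_of_nonneg hx0]
    simp only [Real.norm_of_nonneg hx0, ← Real.norm_eq_abs]
    gcongr
  have hcont : ContinuousWithinAt (fun x : ℝ => x ^ ((1 : ℝ) / 2) * κ x) (Set.Ici 0) 0 :=
    ((Real.continuousAt_rpow_const 0 _ (Or.inr (by norm_num))).mul
      hκ.continuous.continuousAt).continuousWithinAt
  have h := integral_Ioi_of_hasDerivAt_of_tendsto hcont hder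
    ((hint.const_mul (1 / 2)).add hint') hlim
  rw [integral_add (hint.const_mul (1 / 2)) hint', integral_const_mul, hzero] at h
  linarith

/-- For a polynomial `g` and a `C²` function `κ` vanishing outside `[ε₀,∞)` (`ε₀ > 0`) and
rapidly decaying together with its derivatives,
`-∫_0^∞ ∫_ℝ z g(z/√x) ∂_x[φ(z;0,x)κ(x)] dz dx
 = ½(∫_0^∞ x^{-1/2} κ(x) dx)(∫_ℝ g(y)(2y - y³) φ(y;0,1) dy)`. -/
theorem statement12 (P : Polynomial ℝ) (κ : ℝ → ℝ) (ε₀ : ℝ) (hε₀ : 0 < ε₀)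
    (hκsupp : ∀ x < ε₀, κ x = 0)
    (hκC2 : ContDiff ℝ 2 κ)
    (hκdecay : ∀ j ≤ 2, ∀ q : ℕ,
      Tendsto (fun x => x ^ q * iteratedDeriv j κ x) atTop (nhds 0)) :
    -(∫ x in Set.Ioi (0:ℝ),
        (∫ z, z * P.eval (z / Real.sqrt x) * deriv (fun x' => normDens z x' * κ x') x))
      = (1 / 2) * (∫ x in Set.Ioi (0:ℝ), x ^ (-(1:ℝ)/2) * κ x)
          * ∫ y, P.eval y * (2 * y - y ^ 3) * normDens y 1 := by
  have hd : Differentiable ℝ κ := hκC2.differentiable (by norm_num)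
  have hd' : Continuous (deriv κ) := hκC2.continuous_deriv (by norm_num)
  have hsupp' : ∀ x < ε₀, deriv κ x = 0 := by
    intro x hx
    have : κ =ᶠ[nhds x] fun _ => 0 := by
      filter_upwards [Iio_mem_nhds hx] with y hy using hκsupp y hy
    simpa using this.deriv_eq
  have hdec (q : ℕ) : Tendsto (fun x => x ^ q * κ x) atTop (nhds 0) := by
    simpa using hκdecay 0 (by norm_num) q
  have hdec' : Tendsto (fun x => x ^ 3 * deriv κ x) atTop (nhds 0) := by
    simpa using hκdecay 1 (by norm_num) 3
  have hint : IntegrableOn (fun x => x ^ (-(1 : ℝ) / 2) * κ x) (Set.Ioi 0) :=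
    integrableOn_Ioi_rpow_mul_of_rapid_decay hε₀ hκsupp hd.continuous (by norm_num) (hdec 3)
  have hint' : IntegrableOn (fun x => x ^ ((1 : ℝ) / 2) * deriv κ x) (Set.Ioi 0) :=
    integrableOn_Ioi_rpow_mul_of_rapid_decay hε₀ hsupp' hd' (by norm_num) hdec'
  have hgauss : ∫ y, P.eval y * (2 * y - y ^ 3) * normDens y 1
      = 2 * (∫ y, (Polynomial.X * P).eval y * normDens y 1)
        - ∫ y, (Polynomial.X ^ 3 * P).eval y * normDens y 1 := by
    rw [← integral_const_mul, ← integral_sub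
      ((integrable_polynomial_mul_normDens _).const_mul 2) (integrable_polynomial_mul_normDens _)]
    congr 1 with y
    simp only [Polynomial.eval_mul, Polynomial.eval_pow, Polynomial.eval_X]
    ring
  rw [setIntegral_congr_fun measurableSet_Ioi fun x hx =>
      integral_mul_deriv_normDens_mul P hx (hd x).hasDerivAt,
    integral_add ((hint.mul_const _).mul_const _) (hint'.mul_const _), integral_mul_const,
    integral_mul_const, integral_mul_const,
    integral_Ioi_rpow_half_mul_deriv hd (hκsupp 0 hε₀) (hdec 1) hint hint', hgauss]
  ring
end
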